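/- Let U ∈ ℝ^{p×q} and let s be a positive integer with s ≤ pq. Let I be a set of s indices on which |U| is largest (i.e., |I| = s and every entry of U indexed by I has absolute value at least as large as every entry of U outside I), and assume U_I ≠ 0. Then S* = U_I/‖U_I‖_F satisfies ‖S*‖_0 ≤ s and ‖S*‖_F = 1, and for every S ∈ ℝ^{p×q} with ‖S‖_0 ≤ s and ‖S‖_F = 1 one has ‖S* − U‖_F ≤ ‖S − U‖_F. In other words, the projection of U onto the set of unit-Frobenius-norm matrices with at most s non-zero entries is obtained by keeping the s largest-magnitude entries of U, zeroing the others, and normalizing. -/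

import Mathlib

noncomputable def frobNorm {p q : ℕ} (A : Matrix (Fin p) (Fin q) ℝ) : ℝ :=
  Real.sqrt (∑ i, ∑ j, A i j ^ 2)

noncomputable def restrict {p q : ℕ} (A : Matrix (Fin p) (Fin q) ℝ)
    (T : Finset (Fin p × Fin q)) : Matrix (Fin p) (Fin q) ℝ :=
  Matrix.of fun i j => if (i, j) ∈ T then A i j else 0

open Classical in
noncomputable def l0 {p q : ℕ} (A : Matrix (Fin p) (Fin q) ℝ) : ℕ :=
  (Finset.univ.filter fun ij : Fin p × Fin q => A ij.1 ij.2 ≠ 0).card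

theorem Finset.sum_le_sum_of_card_le_of_dominates {α : Type*} [DecidableEq α] {f : α → ℝ}
    (hf : ∀ a, 0 ≤ f a) {T I : Finset α} (hcard : T.card ≤ I.card)
    (hdom : ∀ a ∈ I, ∀ b ∉ I, f b ≤ f a) : ∑ x ∈ T, f x ≤ ∑ x ∈ I, f x := by
  rw [← Finset.sum_inter_add_sum_sdiff T I f, ← Finset.sum_inter_add_sum_sdiff I T f,
    Finset.inter_comm I T]
  refine add_le_add_right ?_ _
  have hc : (T \ I).card ≤ (I \ T).card := Finset.card_sdiff_le_card_sdiff_iff.2 hcard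
  rcases (I \ T).eq_empty_or_nonempty with h | h
  · have hT : T \ I = ∅ := Finset.card_eq_zero.1 (by simpa [h] using hc)
    rw [h, hT]
  · obtain ⟨m, hm, hmin⟩ := Finset.exists_min_image (I \ T) f h
    calc ∑ x ∈ T \ I, f x ≤ (T \ I).card • f m :=
          Finset.sum_le_card_nsmul _ _ _ fun x hx =>
            hdom m (Finset.mem_sdiff.1 hm).1 x (Finset.mem_sdiff.1 hx).2
      _ ≤ (I \ T).card • f m := nsmul_le_nsmul_left (hf m) hc
      _ ≤ ∑ x ∈ I \ T, f x := Finset.card_nsmul_le_sum _ _ _ hmin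

theorem frobNorm_nonneg {p q : ℕ} (A : Matrix (Fin p) (Fin q) ℝ) : 0 ≤ frobNorm A :=
  Real.sqrt_nonneg _

theorem frobNorm_sq {p q : ℕ} (A : Matrix (Fin p) (Fin q) ℝ) :
    frobNorm A ^ 2 = ∑ x : Fin p × Fin q, A x.1 x.2 ^ 2 := by
  rw [frobNorm, Real.sq_sqrt (by positivity), Fintype.sum_prod_type]

theorem frobNorm_eq_zero_iff {p q : ℕ} {A : Matrix (Fin p) (Fin q) ℝ} :
    frobNorm A = 0 ↔ A = 0 := by
  rw [← sq_eq_zero_iff, frobNorm_sq, Finset.sum_eq_zero_iff_of_nonneg fun _ _ => sq_nonneg _]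
  simp [← Matrix.ext_iff]

theorem frobNorm_smul {p q : ℕ} (c : ℝ) (A : Matrix (Fin p) (Fin q) ℝ) :
    frobNorm (c • A) = |c| * frobNorm A := by
  refine (sq_eq_sq₀ (frobNorm_nonneg _) (mul_nonneg (abs_nonneg c) (frobNorm_nonneg A))).1 ?_
  rw [mul_pow, sq_abs, frobNorm_sq, frobNorm_sq, Finset.mul_sum]
  simp [mul_pow]

theorem frobNorm_sub_sq {p q : ℕ} (A B : Matrix (Fin p) (Fin q) ℝ) :
    frobNorm (A - B) ^ 2 = frobNorm A ^ 2
      - 2 * ∑ x : Fin p × Fin q, A x.1 x.2 * B x.1 x.2 + frobNorm B ^ 2 := by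
  simp only [frobNorm_sq, Finset.mul_sum, ← Finset.sum_sub_distrib, ← Finset.sum_add_distrib,
    Matrix.sub_apply]
  exact Finset.sum_congr rfl fun x _ => by ring

theorem sum_restrict_mul {p q : ℕ} (A : Matrix (Fin p) (Fin q) ℝ)
    (T : Finset (Fin p × Fin q)) :
    ∑ x : Fin p × Fin q, restrict A T x.1 x.2 * A x.1 x.2 = ∑ x ∈ T, A x.1 x.2 ^ 2 := by
  simp [restrict, ite_mul, ← sq]

theorem frobNorm_restrict_sq {p q : ℕ} (A : Matrix (Fin p) (Fin q) ℝ)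
    (T : Finset (Fin p × Fin q)) :
    frobNorm (restrict A T) ^ 2 = ∑ x ∈ T, A x.1 x.2 ^ 2 := by
  simp [frobNorm_sq, restrict, ite_pow]

theorem l0_smul_restrict_le {p q : ℕ} (c : ℝ) (A : Matrix (Fin p) (Fin q) ℝ)
    (T : Finset (Fin p × Fin q)) : l0 (c • restrict A T) ≤ T.card := by
  refine Finset.card_le_card fun x hx => ?_
  by_contra h
  simp [restrict, h] at hx

/-- Among matrices with at most `I.card` non-zero entries, the inner product with `U` is bounded
by the Cauchy–Schwarz bound attained on the largest entries of `U`. -/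
theorem sum_mul_le_frobNorm_mul_frobNorm_restrict {p q : ℕ} (S U : Matrix (Fin p) (Fin q) ℝ)
    {I : Finset (Fin p × Fin q)} (hS : l0 S ≤ I.card)
    (hI : ∀ a ∈ I, ∀ b ∉ I, |U b.1 b.2| ≤ |U a.1 a.2|) :
    ∑ x : Fin p × Fin q, S x.1 x.2 * U x.1 x.2 ≤ frobNorm S * frobNorm (restrict U I) := by
  classical
  set T := Finset.univ.filter fun x : Fin p × Fin q => S x.1 x.2 ≠ 0 with hT
  have hTcard : T.card ≤ I.card := by simpa only [hT, l0] using hS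
  have hsupp : ∑ x : Fin p × Fin q, S x.1 x.2 * U x.1 x.2 = ∑ x ∈ T, S x.1 x.2 * U x.1 x.2 := by
    refine (Finset.sum_subset (Finset.subset_univ T) fun x _ hx => ?_).symm
    have : S x.1 x.2 = 0 := by simpa [hT] using hx
    rw [this, zero_mul]
  refine le_of_abs_le <| abs_le_of_sq_le_sq ?_ (mul_nonneg (frobNorm_nonneg S) (frobNorm_nonneg _))
  rw [hsupp, mul_pow, frobNorm_restrict_sq, frobNorm_sq]
  refine (Finset.sum_mul_sq_le_sq_mul_sq _ _ _).trans ?_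
  gcongr ?_ * ?_
  · exact Finset.sum_le_sum_of_subset_of_nonneg (Finset.subset_univ T) fun _ _ _ => sq_nonneg _
  · exact Finset.sum_le_sum_of_card_le_of_dominates (f := fun x => U x.1 x.2 ^ 2)
      (fun _ => sq_nonneg _) hTcard fun a ha b hb => sq_le_sq.2 (hI a ha b hb)

/-- The projection of `U` onto the set of unit-Frobenius-norm matrices with at most `s`
non-zero entries is obtained by keeping the `s` largest-magnitude entries of `U`,
zeroing the others, and normalizing. -/
theorem projection_global_sparsity
    {p q : ℕ} (U : Matrix (Fin p) (Fin q) ℝ)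
    (s : ℕ) (hs : 0 < s) (hspq : s ≤ p * q)
    (I : Finset (Fin p × Fin q))
    (hIcard : I.card = s)
    (hImax : ∀ a ∈ I, ∀ b ∉ I, |U b.1 b.2| ≤ |U a.1 a.2|)
    (hne : restrict U I ≠ 0)
    (Sstar : Matrix (Fin p) (Fin q) ℝ)
    (hSstar : Sstar = (frobNorm (restrict U I))⁻¹ • restrict U I) :
    l0 Sstar ≤ s ∧ frobNorm Sstar = 1 ∧
      ∀ S : Matrix (Fin p) (Fin q) ℝ, l0 S ≤ s → frobNorm S = 1 →
        frobNorm (Sstar - U) ≤ frobNorm (S - U) := by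
  have hpos : 0 < frobNorm (restrict U I) :=
    (frobNorm_nonneg _).lt_of_ne' (frobNorm_eq_zero_iff.not.2 hne)
  have hnorm : frobNorm Sstar = 1 := by
    rw [hSstar, frobNorm_smul, abs_of_pos (inv_pos.2 hpos), inv_mul_cancel₀ hpos.ne']
  refine ⟨by rw [hSstar, ← hIcard]; exact l0_smul_restrict_le _ _ _, hnorm, fun S hS hS1 => ?_⟩
  have hstar : ∑ x : Fin p × Fin q, Sstar x.1 x.2 * U x.1 x.2 = frobNorm (restrict U I) := by
    simp only [hSstar, Matrix.smul_apply, smul_eq_mul, mul_assoc]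
    rw [← Finset.mul_sum, sum_restrict_mul, ← frobNorm_restrict_sq]
    field_simp
  have hle := sum_mul_le_frobNorm_mul_frobNorm_restrict S U (hS.trans hIcard.ge) hImax
  rw [hS1, one_mul] at hle
  refine (sq_le_sq₀ (frobNorm_nonneg _) (frobNorm_nonneg _)).1 ?_
  rw [frobNorm_sub_sq, frobNorm_sub_sq, hnorm, hS1, hstar]
  linarith
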